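/- Let k > 0, assume that every vertex of G is incident with at least one edge and that G has at least 2k edges. If τ is a tangle of S_{2k}(E), then τ_X ∩ S_k(X) is a tangle of S_k(X), where τ_X := {(C,D)^◀ : (C,D) ∈ τ}. -/

import Mathlib

open Finset

namespace BipSep

variable {X Y : Type*} [Fintype X] [Fintype Y] [DecidableEq X] [DecidableEq Y]

/-- `|N(y) ∩ A|`: the number of neighbours of `y` in `A ⊆ X`, where the bipartite graph is
given by the adjacency relation `R : X → Y → Prop`. -/
def nX (R : X → Y → Prop) [∀ x y, Decidable (R x y)] (y : Y) (A : Finset X) : ℕ :=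
  (A.filter fun x => R x y).card

/-- `|N(x) ∩ C|` for `C ⊆ Y`. -/
def nY (R : X → Y → Prop) [∀ x y, Decidable (R x y)] (x : X) (C : Finset Y) : ℕ :=
  (C.filter fun y => R x y).card

/-- The order `|A,B|_X` of a separation `(A,B)` of `X`. -/
def ordX (R : X → Y → Prop) [∀ x y, Decidable (R x y)] (A B : Finset X) : ℚ :=
  ∑ y : Y, ((min (nX R y A) (nX R y B) : ℚ) - (nX R y (A ∩ B) : ℚ) / 2)

/-- The order `|C,D|_Y` of a separation `(C,D)` of `Y`. -/
def ordY (R : X → Y → Prop) [∀ x y, Decidable (R x y)] (C D : Finset Y) : ℚ :=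
  ∑ x : X, ((min (nY R x C) (nY R x D) : ℚ) - (nY R x (C ∩ D) : ℚ) / 2)

/-- `A^▷_B := {y ∈ Y : |N(y) ∩ A| ≥ |N(y) ∩ B|}`. -/
def shiftR1 (R : X → Y → Prop) [∀ x y, Decidable (R x y)] (A B : Finset X) : Finset Y :=
  univ.filter fun y => nX R y B ≤ nX R y A

/-- `B^▷_A := {y ∈ Y : |N(y) ∩ A| ≤ |N(y) ∩ B|}`. -/
def shiftR2 (R : X → Y → Prop) [∀ x y, Decidable (R x y)] (A B : Finset X) : Finset Y :=
  univ.filter fun y => nX R y A ≤ nX R y B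

/-- `C^◁_D := {x ∈ X : |N(x) ∩ C| ≥ |N(x) ∩ D|}`. -/
def shiftL1 (R : X → Y → Prop) [∀ x y, Decidable (R x y)] (C D : Finset Y) : Finset X :=
  univ.filter fun x => nY R x D ≤ nY R x C

/-- `D^◁_C := {x ∈ X : |N(x) ∩ C| ≤ |N(x) ∩ D|}`. -/
def shiftL2 (R : X → Y → Prop) [∀ x y, Decidable (R x y)] (C D : Finset Y) : Finset X :=
  univ.filter fun x => nY R x C ≤ nY R x D

instance (R : X → Y → Prop) [∀ x y, Decidable (R x y)] :
    DecidablePred fun p : X × Y => R p.1 p.2 :=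
  fun p => inferInstanceAs (Decidable (R p.1 p.2))

/-- The edge set of the bipartite graph with adjacency relation `R`: an edge is a pair
`(x,y)` with `x ∈ X`, `y ∈ Y` and `x` adjacent to `y`. -/
abbrev Edge (R : X → Y → Prop) := {p : X × Y // R p.1 p.2}

/-- `|E(x) ∩ C|` for a set `C` of edges. -/
def eX (R : X → Y → Prop) [∀ x y, Decidable (R x y)] (x : X) (C : Finset (Edge R)) : ℕ :=
  (C.filter fun e => e.1.1 = x).card

/-- `|E(y) ∩ C|` for a set `C` of edges. -/
def eY (R : X → Y → Prop) [∀ x y, Decidable (R x y)] (y : Y) (C : Finset (Edge R)) : ℕ :=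
  (C.filter fun e => e.1.2 = y).card

/-- The order `|C,D|_E` of a separation `(C,D)` of the edge set `E`. -/
def ordE (R : X → Y → Prop) [∀ x y, Decidable (R x y)] (C D : Finset (Edge R)) : ℚ :=
  (∑ x : X, ((min (eX R x C) (eX R x D) : ℚ) - (eX R x (C ∩ D) : ℚ) / 2)) +
    ∑ y : Y, ((min (eY R y C) (eY R y D) : ℚ) - (eY R y (C ∩ D) : ℚ) / 2)

/-- `C^◀_D := {x ∈ X : |E(x) ∩ C| ≥ |E(x) ∩ D|}`. -/
def bshift1 (R : X → Y → Prop) [∀ x y, Decidable (R x y)] (C D : Finset (Edge R)) : Finset X :=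
  univ.filter fun x => eX R x D ≤ eX R x C

/-- `D^◀_C := {x ∈ X : |E(x) ∩ C| ≤ |E(x) ∩ D|}`. -/
def bshift2 (R : X → Y → Prop) [∀ x y, Decidable (R x y)] (C D : Finset (Edge R)) : Finset X :=
  univ.filter fun x => eX R x C ≤ eX R x D

/-- `E(A)`: the set of edges with an endpoint in `A ⊆ X`. -/
def edgesOf (R : X → Y → Prop) [∀ x y, Decidable (R x y)] (A : Finset X) : Finset (Edge R) :=
  univ.filter fun e => e.1.1 ∈ A

/-- `|E(S,T)|`: the number of edges with `X`-endpoint in `T` and `Y`-endpoint in `S`. -/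
def eCount (R : X → Y → Prop) [∀ x y, Decidable (R x y)] (T : Finset X) (S : Finset Y) : ℕ :=
  (univ.filter fun e : Edge R => e.1.1 ∈ T ∧ e.1.2 ∈ S).card

/-- `S_k`: the set of oriented separations of order `< k`, with respect to the
order function `ord`. -/
def Sk {V : Type*} [Fintype V] [DecidableEq V] (ord : Finset V → Finset V → ℚ) (k : ℚ) :
    Set (Finset V × Finset V) :=
  {p | p.1 ∪ p.2 = univ ∧ ord p.1 p.2 < k}

/-- A tangle of `S_k`: a set of oriented separations, all of order `< k`, containing exactly
one of `(A,B)`, `(B,A)` for every separation of order `< k`, such that no three of its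
members have their left-hand sides covering the whole ground set. -/
def IsTangle {V : Type*} [Fintype V] [DecidableEq V] (ord : Finset V → Finset V → ℚ)
    (k : ℚ) (τ : Set (Finset V × Finset V)) : Prop :=
  (∀ p ∈ τ, p.1 ∪ p.2 = univ ∧ ord p.1 p.2 < k) ∧
  (∀ A B : Finset V, A ∪ B = univ → ord A B < k → ((A, B) ∈ τ ↔ (B, A) ∉ τ)) ∧
  ∀ p₁ ∈ τ, ∀ p₂ ∈ τ, ∀ p₃ ∈ τ, p₁.1 ∪ p₂.1 ∪ p₃.1 ≠ univ

/-- A profile of `S_k`: an orientation of `S_k` that is consistent and closed under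
the profile property. -/
def IsProfile {V : Type*} [Fintype V] [DecidableEq V] (ord : Finset V → Finset V → ℚ)
    (k : ℚ) (P : Set (Finset V × Finset V)) : Prop :=
  (∀ p ∈ P, p.1 ∪ p.2 = univ ∧ ord p.1 p.2 < k) ∧
  (∀ A B : Finset V, A ∪ B = univ → ord A B < k → ((A, B) ∈ P ↔ (B, A) ∉ P)) ∧
  (∀ A₁ B₁ A₂ B₂ : Finset V, A₁ ⊆ A₂ → B₂ ⊆ B₁ →
    ¬((A₁ = A₂ ∧ B₁ = B₂) ∨ (A₁ = B₂ ∧ B₁ = A₂)) →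
    ¬((B₁, A₁) ∈ P ∧ (A₂, B₂) ∈ P)) ∧
  ∀ p₁ ∈ P, ∀ p₂ ∈ P, (p₁.2 ∩ p₂.2, p₁.1 ∪ p₂.1) ∉ P

/-- A regular profile: a profile containing no separation of the form `(V,B)`. -/
def IsRegularProfile {V : Type*} [Fintype V] [DecidableEq V] (ord : Finset V → Finset V → ℚ)
    (k : ℚ) (P : Set (Finset V × Finset V)) : Prop :=
  IsProfile ord k P ∧ ∀ B : Finset V, (univ, B) ∉ P

/-- `^▷τ`: the separations `(C,D)` of `Y` whose shift `(C,D)^◁` lies in `τ`. -/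
def pullY (R : X → Y → Prop) [∀ x y, Decidable (R x y)] (τ : Set (Finset X × Finset X)) :
    Set (Finset Y × Finset Y) :=
  {q | q.1 ∪ q.2 = univ ∧ (shiftL1 R q.1 q.2, shiftL2 R q.1 q.2) ∈ τ}

/-- `^◁τ`: the separations `(A,B)` of `X` whose shift `(A,B)^▷` lies in `τ`. -/
def pullX (R : X → Y → Prop) [∀ x y, Decidable (R x y)] (τ : Set (Finset Y × Finset Y)) :
    Set (Finset X × Finset X) :=
  {p | p.1 ∪ p.2 = univ ∧ (shiftR1 R p.1 p.2, shiftR2 R p.1 p.2) ∈ τ}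

/-- `τ_E`: the separations `(C,D)` of `E` whose shift `(C,D)^◀` lies in `τ`. -/
def pullE (R : X → Y → Prop) [∀ x y, Decidable (R x y)] (τ : Set (Finset X × Finset X)) :
    Set (Finset (Edge R) × Finset (Edge R)) :=
  {q | q.1 ∪ q.2 = univ ∧ (bshift1 R q.1 q.2, bshift2 R q.1 q.2) ∈ τ}

/-- `τ_X := {(C,D)^◀ : (C,D) ∈ τ}`. -/
def pushX (R : X → Y → Prop) [∀ x y, Decidable (R x y)]
    (τ : Set (Finset (Edge R) × Finset (Edge R))) : Set (Finset X × Finset X) :=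
  {p | ∃ q ∈ τ, (bshift1 R q.1 q.2, bshift2 R q.1 q.2) = p}


section

variable (R : X → Y → Prop) [∀ x y, Decidable (R x y)]

lemma eX_mono (x : X) {C D : Finset (Edge R)} (h : C ⊆ D) : eX R x C ≤ eX R x D :=
  card_le_card (filter_subset_filter _ h)

lemma eY_mono (y : Y) {C D : Finset (Edge R)} (h : C ⊆ D) : eY R y C ≤ eY R y D :=
  card_le_card (filter_subset_filter _ h)

lemma nX_mono (y : Y) {A B : Finset X} (h : A ⊆ B) : nX R y A ≤ nX R y B :=
  card_le_card (filter_subset_filter _ h)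

lemma sum_eX (C : Finset (Edge R)) : ∑ x, (eX R x C : ℚ) = C.card := by
  rw [card_eq_sum_card_fiberwise (f := fun e : Edge R => e.1.1) (t := univ) (by simp)]
  simp [eX]

lemma sum_eY (C : Finset (Edge R)) : ∑ y, (eY R y C : ℚ) = C.card := by
  rw [card_eq_sum_card_fiberwise (f := fun e : Edge R => e.1.2) (t := univ) (by simp)]
  simp [eY]

lemma eX_edgesOf (x : X) (A : Finset X) :
    eX R x (edgesOf R A) = if x ∈ A then eX R x univ else 0 := by
  unfold eX edgesOf
  split_ifs with h
  · congr 1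
    ext e
    simp only [mem_filter, mem_univ, true_and, and_iff_right_iff_imp]
    rintro rfl
    exact h
  · rw [card_eq_zero, filter_eq_empty_iff]
    rintro e he rfl
    exact h (mem_filter.1 he).2

lemma eY_edgesOf (y : Y) (A : Finset X) : eY R y (edgesOf R A) = nX R y A := by
  unfold eY edgesOf nX
  refine card_bij (fun e _ => e.1.1) ?_ ?_ ?_
  · rintro ⟨⟨x, z⟩, h⟩ he
    simp only [mem_filter, mem_univ, true_and] at he ⊢
    obtain ⟨hx, rfl⟩ := he
    exact ⟨hx, h⟩
  · rintro ⟨⟨x, z⟩, h⟩ he ⟨⟨x', z'⟩, h'⟩ he' hxx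
    simp only [mem_filter, mem_univ, true_and] at he he' hxx
    simp [hxx, he.2, he'.2]
  · intro x hx
    simp only [mem_filter] at hx
    exact ⟨⟨(x, y), hx.2⟩, by simp [hx.1], rfl⟩

lemma edgesOf_inter (A B : Finset X) :
    edgesOf R (A ∩ B) = edgesOf R A ∩ edgesOf R B := by
  ext e
  simp [edgesOf]

lemma edgesOf_union (A B : Finset X) :
    edgesOf R (A ∪ B) = edgesOf R A ∪ edgesOf R B := by
  ext e
  simp [edgesOf]

lemma edgesOf_univ : edgesOf R (univ : Finset X) = univ := by
  ext e
  simp [edgesOf]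

lemma ordX_comm (A B : Finset X) : ordX R A B = ordX R B A := by
  simp only [ordX, min_comm, inter_comm]

/-- The separation of `E` induced by a separation of `X` has at most twice its order. -/
lemma ordE_edgesOf_le (A B : Finset X) :
    ordE R (edgesOf R A) (edgesOf R B) ≤ 2 * ordX R A B := by
  have hx : ∑ x : X, ((min (eX R x (edgesOf R A)) (eX R x (edgesOf R B)) : ℚ)
      - (eX R x (edgesOf R A ∩ edgesOf R B) : ℚ) / 2) = (edgesOf R (A ∩ B)).card / 2 := by
    rw [← sum_eX, sum_div]
    refine sum_congr rfl fun x _ => ?_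
    rw [← edgesOf_inter]
    simp only [eX_edgesOf, mem_inter]
    by_cases hA : x ∈ A <;> by_cases hB : x ∈ B <;> simp [hA, hB, sub_half]
  have hy : ((edgesOf R (A ∩ B)).card : ℚ) / 2 ≤ ordX R A B := by
    rw [← sum_eY, sum_div]
    refine sum_le_sum fun y _ => ?_
    rw [eY_edgesOf]
    have h₁ : (nX R y (A ∩ B) : ℚ) ≤ nX R y A := mod_cast nX_mono R y inter_subset_left
    have h₂ : (nX R y (A ∩ B) : ℚ) ≤ nX R y B := mod_cast nX_mono R y inter_subset_right
    have := le_min h₁ h₂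
    linarith
  have hE : ordE R (edgesOf R A) (edgesOf R B)
      = (edgesOf R (A ∩ B)).card / 2 + ordX R A B := by
    unfold ordE
    rw [hx, ← edgesOf_inter]
    simp only [eY_edgesOf, ordX]
  linarith

lemma ordE_univ_right (F : Finset (Edge R)) : ordE R F univ = F.card := by
  have hx (x : X) : min (eX R x F : ℚ) (eX R x univ) = eX R x F :=
    min_eq_left (mod_cast eX_mono R x (subset_univ F))
  have hy (y : Y) : min (eY R y F : ℚ) (eY R y univ) = eY R y F :=
    min_eq_left (mod_cast eY_mono R y (subset_univ F))
  simp only [ordE, hx, hy, inter_univ, sum_sub_distrib, ← sum_div, sum_eX, sum_eY]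
  ring

/-- There are at most `|C,D|_E` edges which lie neither in `C` nor at a vertex of the right-hand
side of the shift of `(C,D)`. -/
lemma card_compl_le_ordE {C D : Finset (Edge R)} (hCD : C ∪ D = univ) :
    (((C ∪ edgesOf R (bshift2 R C D))ᶜ).card : ℚ) ≤ ordE R C D := by
  set F := (C ∪ edgesOf R (bshift2 R C D))ᶜ with hF
  have hy : 0 ≤ ∑ y : Y, ((min (eY R y C) (eY R y D) : ℚ) - (eY R y (C ∩ D) : ℚ) / 2) := by
    refine sum_nonneg fun y _ => ?_
    have h₁ : (eY R y (C ∩ D) : ℚ) ≤ eY R y C := mod_cast eY_mono R y inter_subset_left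
    have h₂ : (eY R y (C ∩ D) : ℚ) ≤ eY R y D := mod_cast eY_mono R y inter_subset_right
    have h₃ := le_min h₁ h₂
    have h₄ : (0 : ℚ) ≤ eY R y (C ∩ D) := Nat.cast_nonneg _
    linarith
  have hx : (F.card : ℚ)
      ≤ ∑ x : X, ((min (eX R x C) (eX R x D) : ℚ) - (eX R x (C ∩ D) : ℚ) / 2) := by
    rw [← sum_eX]
    refine sum_le_sum fun x _ => ?_
    have h₁ : (eX R x (C ∩ D) : ℚ) ≤ eX R x C := mod_cast eX_mono R x inter_subset_left
    have h₂ : (eX R x (C ∩ D) : ℚ) ≤ eX R x D := mod_cast eX_mono R x inter_subset_right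
    have h₃ : (0 : ℚ) ≤ eX R x (C ∩ D) := Nat.cast_nonneg _
    by_cases hxB : eX R x C ≤ eX R x D
    · have h₀ : eX R x F = 0 := by
        rw [eX, card_eq_zero, filter_eq_empty_iff]
        rintro e he rfl
        simp only [hF, edgesOf, bshift2, mem_compl, mem_union, mem_filter, mem_univ, true_and,
          not_or] at he
        exact he.2 hxB
      have := le_min h₁ h₂
      rw [h₀, Nat.cast_zero]
      linarith
    · have h₄ : eX R x F + eX R x (C ∩ D) ≤ eX R x D := by
        have hdisj : Disjoint F (C ∩ D) :=
          disjoint_left.2 fun e he he' => mem_compl.1 he (mem_union_left _ (mem_inter.1 he').1)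
        have hsub : F ∪ C ∩ D ⊆ D := by
          refine union_subset (fun e he => ?_) inter_subset_right
          have : e ∈ C ∪ D := hCD ▸ mem_univ e
          exact (mem_union.1 this).resolve_left
            fun hC => mem_compl.1 he (mem_union_left _ hC)
        unfold eX
        rw [← card_union_of_disjoint (disjoint_filter_filter hdisj), ← filter_union]
        exact card_le_card (filter_subset_filter _ hsub)
      have h₅ : (eX R x F : ℚ) + eX R x (C ∩ D) ≤ eX R x D := mod_cast h₄
      have h₆ : min (eX R x C : ℚ) (eX R x D) = eX R x D :=
        min_eq_right (mod_cast (not_le.1 hxB).le)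
      rw [h₆]
      linarith
  unfold ordE
  linarith

variable {R}

lemma eX_univ_pos {x : X} (h : ∃ y, R x y) : 0 < eX R x univ := by
  obtain ⟨y, hy⟩ := h
  exact card_pos.2 ⟨⟨(x, y), hy⟩, by simp⟩

lemma bshift1_edgesOf (hdegX : ∀ x : X, ∃ y : Y, R x y) {A B : Finset X}
    (hAB : A ∪ B = univ) : bshift1 R (edgesOf R A) (edgesOf R B) = A := by
  ext x
  have hpos := eX_univ_pos (hdegX x)
  have hx : x ∈ A ∨ x ∈ B := mem_union.1 (hAB ▸ mem_univ x)
  simp only [bshift1, mem_filter, mem_univ, true_and, eX_edgesOf]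
  by_cases hA : x ∈ A <;> by_cases hB : x ∈ B <;> simp_all <;> omega

lemma bshift2_edgesOf (hdegX : ∀ x : X, ∃ y : Y, R x y) {A B : Finset X}
    (hAB : A ∪ B = univ) : bshift2 R (edgesOf R A) (edgesOf R B) = B :=
  bshift1_edgesOf hdegX (union_comm A B ▸ hAB)

/-- A tangle of the edge set contains every small separation `(F,E)`. -/
lemma mem_of_card_lt {k : ℚ} {τ : Set (Finset (Edge R) × Finset (Edge R))}
    (hτ : IsTangle (ordE R) k τ) {F : Finset (Edge R)} (hF : (F.card : ℚ) < k) :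
    (F, univ) ∈ τ := by
  refine (hτ.2.1 F univ (by simp) (by rwa [ordE_univ_right])).2 fun h => ?_
  exact hτ.2.2 _ h _ h _ h (by simp)

/-- A separation `(A,B)` of `X` lies in `τ_X` iff the induced separation of `E` lies in `τ`. -/
lemma mem_pushX_iff (hdegX : ∀ x : X, ∃ y : Y, R x y) {k : ℚ}
    {τ : Set (Finset (Edge R) × Finset (Edge R))} (hτ : IsTangle (ordE R) (2 * k) τ)
    {A B : Finset X} (hAB : A ∪ B = univ) (hord : ordX R A B < k) :
    (A, B) ∈ pushX R τ ↔ (edgesOf R A, edgesOf R B) ∈ τ := by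
  constructor
  · rintro ⟨⟨C, D⟩, hCD, heq⟩
    simp only [Prod.mk.injEq] at heq
    have hle := ordE_edgesOf_le R A B
    refine (hτ.2.1 _ _ (by rw [← edgesOf_union, hAB, edgesOf_univ])
      (by linarith)).2 fun hBA => ?_
    obtain ⟨hcov, hlt⟩ := hτ.1 _ hCD
    have hF := mem_of_card_lt hτ ((card_compl_le_ordE R hcov).trans_lt hlt)
    rw [heq.2] at hF
    exact hτ.2.2 _ hCD _ hBA _ hF (union_compl _)
  · exact fun h => ⟨_, h, by rw [bshift1_edgesOf hdegX hAB, bshift2_edgesOf hdegX hAB]⟩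

end

/-- If `τ` is a tangle of `S_{2k}(E)`, then `τ_X ∩ S_k(X)` is a tangle of `S_k(X)`. -/
theorem edges_to_vtx (R : X → Y → Prop) [∀ x y, Decidable (R x y)] (k : ℚ) (hk : 0 < k)
    (hdegX : ∀ x : X, ∃ y : Y, R x y) (hdegY : ∀ y : Y, ∃ x : X, R x y)
    (hE : 2 * k ≤ (Fintype.card (Edge R) : ℚ))
    (τ : Set (Finset (Edge R) × Finset (Edge R))) (hτ : IsTangle (ordE R) (2 * k) τ) :
    IsTangle (ordX R) k (pushX R τ ∩ Sk (ordX R) k) := by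
  refine ⟨fun p hp => hp.2, fun A B hAB hord => ?_, ?_⟩
  · have hBA : B ∪ A = univ := union_comm A B ▸ hAB
    have hord' : ordX R B A < k := ordX_comm R A B ▸ hord
    have hS : (A, B) ∈ Sk (ordX R) k := ⟨hAB, hord⟩
    have hS' : (B, A) ∈ Sk (ordX R) k := ⟨hBA, hord'⟩
    have hle := ordE_edgesOf_le R A B
    simp only [Set.mem_inter_iff, hS, hS', and_true, mem_pushX_iff hdegX hτ hAB hord,
      mem_pushX_iff hdegX hτ hBA hord']
    exact hτ.2.1 _ _ (by rw [← edgesOf_union, hAB, edgesOf_univ]) (by linarith)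
  · rintro ⟨A₁, B₁⟩ ⟨h₁, hc₁, ho₁⟩ ⟨A₂, B₂⟩ ⟨h₂, hc₂, ho₂⟩ ⟨A₃, B₃⟩ ⟨h₃, hc₃, ho₃⟩ hcov
    refine hτ.2.2 _ ((mem_pushX_iff hdegX hτ hc₁ ho₁).1 h₁) _
      ((mem_pushX_iff hdegX hτ hc₂ ho₂).1 h₂) _ ((mem_pushX_iff hdegX hτ hc₃ ho₃).1 h₃) ?_
    simp only [← edgesOf_union]
    rw [hcov, edgesOf_univ]

end BipSep
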